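/- Let A be a streamlined deterministic parity automaton. The maximal color occurring infinitely often on some co-run of A on a word w equals the natural color of w for the language L(A). -/

import Mathlib

open Classical

universe u v

/-- A deterministic parity automaton with transition-based acceptance. -/
structure DPA (Q : Type u) (A : Type v) where
  init : Q
  trans : Q → A → Q
  color : Q → A → ℕ

/-- A word (or a color sequence) hits value `c` infinitely often. -/
def InfOften (f : ℕ → ℕ) (c : ℕ) : Prop := ∀ N, ∃ n, N ≤ n ∧ f n = c

namespace DPA

variable {Q : Type u} {A : Type v}

/-- The unique run of a DPA from state `q` on infinite word `w`. -/
def runFrom (M : DPA Q A) (q : Q) (w : ℕ → A) : ℕ → Q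
  | 0 => q
  | n + 1 => M.trans (M.runFrom q w n) (w n)

/-- The color sequence of the run from `q` on `w`. -/
def colorsFrom (M : DPA Q A) (q : Q) (w : ℕ → A) (n : ℕ) : ℕ :=
  M.color (M.runFrom q w n) (w n)

/-- The dominating (least infinitely often occurring) color of the run from `q` on `w`. -/
noncomputable def domColorFrom (M : DPA Q A) (q : Q) (w : ℕ → A) : ℕ :=
  sInf {c | InfOften (M.colorsFrom q w) c}

/-- Parity acceptance from a state. -/
def acceptsFrom (M : DPA Q A) (q : Q) (w : ℕ → A) : Prop :=
  Even (M.domColorFrom q w)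

def langFrom (M : DPA Q A) (q : Q) : Set (ℕ → A) := {w | M.acceptsFrom q w}

def lang (M : DPA Q A) : Set (ℕ → A) := M.langFrom M.init

/-- Language equivalence of states. -/
def LangEquiv (M : DPA Q A) (q q' : Q) : Prop := M.langFrom q = M.langFrom q'

/-- Reachability in the transition structure. -/
def Reach (M : DPA Q A) : Q → Q → Prop :=
  Relation.ReflTransGen (fun a b => ∃ x, M.trans a x = b)

/-- A DPA is structured: all states reachable, and language-equivalent states are
mutually reachable (same maximal SCC). -/
def Structured (M : DPA Q A) : Prop :=
  (∀ q, M.Reach M.init q) ∧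
  ∀ q q', M.LangEquiv q q' → M.Reach q q' ∧ M.Reach q' q

noncomputable def maxColor (M : DPA Q A) [Fintype Q] [Fintype A] : ℕ :=
  Finset.univ.sup fun t : Q × A => M.color t.1 t.2

/-- Same transition structure, new coloring. -/
def recolor (M : DPA Q A) (c : Q × A → ℕ) : DPA Q A :=
  ⟨M.init, M.trans, fun q x => c (q, x)⟩

/-- Extension of the transition function to finite words. -/
def runList (M : DPA Q A) (q : Q) (u : List A) : Q := u.foldl M.trans q

end DPA

/-- A (nondeterministic) automaton with colored transitions; used as co-Büchi automaton
(colors 1 = rejecting, 2 = accepting). -/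
structure NCA (Q : Type u) (A : Type v) where
  inits : Set Q
  trans : Set (Q × A × Q × ℕ)

namespace NCA

variable {Q : Type u} {A : Type v}

def IsRun (N : NCA Q A) (w : ℕ → A) (ρ : ℕ → Q) (γ : ℕ → ℕ) : Prop :=
  ρ 0 ∈ N.inits ∧ ∀ n, (ρ n, w n, ρ (n + 1), γ n) ∈ N.trans

/-- Co-Büchi acceptance: some run takes rejecting transitions only finitely often,
i.e. from some point on only accepting (color 2) transitions. -/
def accepts (N : NCA Q A) (w : ℕ → A) : Prop :=
  ∃ ρ γ, N.IsRun w ρ γ ∧ ∃ p, ∀ n, p ≤ n → γ n = 2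

/-- A finite run prefix on a finite word. -/
def FinRunOn (N : NCA Q A) (xs : List A) (ρ : ℕ → Q) (γ : ℕ → ℕ) : Prop :=
  ρ 0 ∈ N.inits ∧ ∀ k (hk : k < xs.length), (ρ k, xs[k], ρ (k + 1), γ k) ∈ N.trans

end NCA

namespace DPA

variable {Q : Type u} {A : Type v}

/-- The co-Büchi automaton `A_i` derived from a DPA: transitions of color ≥ i become
accepting (2), those of color < i rejecting (1), plus rejecting transitions to every
state language-equivalent to the deterministic successor that is not already a target. -/
def derived (M : DPA Q A) (i : ℕ) : NCA Q A where
  inits := {M.init}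
  trans :=
    {t | ∃ q x, t = (q, x, M.trans q x, if i ≤ M.color q x then 2 else 1)} ∪
    {t | ∃ q x q'', q'' ≠ M.trans q x ∧ M.LangEquiv q'' (M.trans q x) ∧ t = (q, x, q'', 1)}

end DPA

/-- State of the streamlining procedure: remaining coloring graph (as set of transitions,
identified by source state and letter), current color assignment, and counter. -/
structure SState (Q : Type u) (A : Type v) where
  graph : Set (Q × A)
  col : Q × A → ℕ
  counter : ℕ

namespace DPA

variable {Q : Type u} {A : Type v}

/-- Edge relation of the coloring graph `G`. -/
def edgeIn (M : DPA Q A) (G : Set (Q × A)) (a b : Q) : Prop :=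
  ∃ x, (a, x) ∈ G ∧ M.trans a x = b

def reachIn (M : DPA Q A) (G : Set (Q × A)) : Q → Q → Prop :=
  Relation.ReflTransGen (M.edgeIn G)

def SameSCC (M : DPA Q A) (G : Set (Q × A)) (a b : Q) : Prop :=
  M.reachIn G a b ∧ M.reachIn G b a

/-- A transition is transient in `G` if it lies on no cycle of `G`. -/
def Transient (M : DPA Q A) (G : Set (Q × A)) (t : Q × A) : Prop :=
  ¬ M.reachIn G (M.trans t.1 t.2) t.1

/-- The least color (under `col`) of transitions lying within the SCC of `q` in `G`. -/
noncomputable def sccMinCol (M : DPA Q A) (G : Set (Q × A)) (col : Q × A → ℕ) (q : Q) : ℕ :=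
  sInf {c | ∃ p x, (p, x) ∈ G ∧ M.SameSCC G p q ∧ M.SameSCC G (M.trans p x) q ∧
    col (p, x) = c}

/-- One step of the streamlining procedure (Carton–Maceiras style):
recolor/remove transient transitions if any; otherwise recolor/remove minimal-color
transitions of SCCs whose minimal color has the counter's parity if any;
otherwise increment the counter. -/
noncomputable def streamStep (M : DPA Q A) (s : SState Q A) : SState Q A :=
  if s.graph = ∅ then s
  else
    let T := {t ∈ s.graph | M.Transient s.graph t}
    if T ≠ ∅ then
      ⟨s.graph \ T, fun t => if t ∈ T then s.counter else s.col t, s.counter⟩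
    else
      let R := {t ∈ s.graph | M.SameSCC s.graph t.1 (M.trans t.1 t.2) ∧
        s.col t = M.sccMinCol s.graph s.col t.1 ∧ s.col t % 2 = s.counter % 2}
      if R ≠ ∅ then
        ⟨s.graph \ R, fun t => if t ∈ R then s.counter else s.col t, s.counter⟩
      else ⟨s.graph, s.col, s.counter + 1⟩

/-- The streamlining procedure after `n` steps, starting from the full transition graph
with the original colors and counter 0. -/
noncomputable def streamRun (M : DPA Q A) (n : ℕ) : SState Q A :=
  (M.streamStep)^[n] ⟨Set.univ, fun t => M.color t.1 t.2, 0⟩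

/-- A co-run: follow the run for a finite prefix, then once jump to a language-equivalent
state and follow the deterministic transitions from there. -/
def IsCoRun (M : DPA Q A) (w : ℕ → A) (σ : ℕ → Q) : Prop :=
  ∃ p, 0 < p ∧ (∀ n, n < p → σ n = M.runFrom M.init w n) ∧
    M.LangEquiv (σ p) (M.runFrom M.init w p) ∧
    ∀ n, p ≤ n → σ (n + 1) = M.trans (σ n) (w n)

/-- The dominating (least infinitely often occurring) color along a co-run. -/
noncomputable def coRunDom (M : DPA Q A) (w : ℕ → A) (σ : ℕ → Q) : ℕ :=
  sInf {c | InfOften (fun n => M.color (σ n) (w n)) c}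

/-- An accepting SCC (for threshold color `i`): a nonempty state set with a nonempty set of
transitions of color ≥ i among them that is strongly connected. -/
def AccSCC (M : DPA Q A) (i : ℕ) (S : Set Q) (T : Set (Q × A)) : Prop :=
  S.Nonempty ∧ T.Nonempty ∧
  (∀ t ∈ T, t.1 ∈ S ∧ M.trans t.1 t.2 ∈ S ∧ i ≤ M.color t.1 t.2) ∧
  ∀ q ∈ S, ∀ q' ∈ S,
    Relation.ReflTransGen (fun a b => ∃ x, (a, x) ∈ T ∧ M.trans a x = b) q q'

/-- Redirect the transition `(s, x)` to target `q'` instead. -/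
noncomputable def redirect (M : DPA Q A) (s : Q) (x : A) (q' : Q) : DPA Q A :=
  ⟨M.init, fun a y => if a = s ∧ y = x then q' else M.trans a y, M.color⟩

end DPA

section Words

variable {A : Type v} [Inhabited A]

/-- Prepend a finite word to an infinite word. -/
def listApp (u : List A) (w : ℕ → A) : ℕ → A :=
  fun n => if n < u.length then u.getD n default else w (n - u.length)

/-- The suffix language of `L` after the finite word `u`. -/
def suffixLang (L : Set (ℕ → A)) (u : List A) : Set (ℕ → A) :=
  {w | listApp u w ∈ L}

/-- `u` is suffix-language-invariant for `L` after `w`. -/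
def SuffixInv (L : Set (ℕ → A)) (u w : List A) : Prop :=
  suffixLang L w = suffixLang L (w ++ u)

/-- The first `n` letters of an infinite word. -/
def prefixList (w : ℕ → A) (n : ℕ) : List A := (List.range n).map w

/-- The finite segment `w a, w (a+1), ..., w (b-1)` of an infinite word. -/
def seg (w : ℕ → A) (a b : ℕ) : List A := (List.range (b - a)).map fun k => w (a + k)

/-- `w'` results from a suffix-language-invariant injection of finite words into `w`
at the positions in `J`: there is a monotone reindexing `f` of the letters of `w`, the
gaps occur only after positions in `J`, and each inserted segment is
suffix-language-invariant for `L` after the corresponding prefix of `w`. -/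
def IsInj (L : Set (ℕ → A)) (w : ℕ → A) (J : Set ℕ) (w' : ℕ → A) : Prop :=
  ∃ f : ℕ → ℕ, f 0 = 0 ∧ (∀ n, w' (f n) = w n) ∧
    (∀ n, n ∉ J → f (n + 1) = f n + 1) ∧
    (∀ n, n ∈ J → f n < f (n + 1) ∧
      SuffixInv L (seg w' (f n + 1) (f (n + 1))) (prefixList w (n + 1)))

/-- `w` is at home in color `i` for the language `L`. -/
def AtHome (L : Set (ℕ → A)) (i : ℕ) (w : ℕ → A) : Prop :=
  ∃ J : Set ℕ, J.Infinite ∧ ∀ w', IsInj L w J w' →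
    (∃ i', ∃ _ : i' < i, AtHome L i' w') ∨
    ((w ∈ L ∧ w' ∈ L ∧ Even i) ∨ (w ∉ L ∧ w' ∉ L ∧ Odd i))
  termination_by i

/-- The natural color of `w` for `L`: the least color `w` is at home in. -/
noncomputable def naturalColor (L : Set (ℕ → A)) (w : ℕ → A) : ℕ :=
  sInf {i | AtHome L i w}

/-- The ultimately periodic word `u v^ω`. -/
def upw (u v : List A) : ℕ → A :=
  fun n => if n < u.length then u.getD n default
           else v.getD ((n - u.length) % v.length) default

/-- Insert the finite word `u` immediately after position `j` of `w`. -/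
def insertWord (w : ℕ → A) (j : ℕ) (u : List A) : ℕ → A :=
  fun n => if n ≤ j then w n
           else if n - (j + 1) < u.length then u.getD (n - (j + 1)) default
           else w (n - u.length)

end Words

section InfinitelyOften

theorem exists_infOften_le {f : ℕ → ℕ} {d : ℕ} (h : ∀ N, ∃ n, N ≤ n ∧ f n ≤ d) :
    ∃ c ≤ d, InfOften f c := by
  by_contra hc
  simp only [InfOften] at hc
  push Not at hc
  choose! N hN using hc
  obtain ⟨n, hn, hle⟩ := h ((Finset.range (d + 1)).sup N)
  have hmem : f n ∈ Finset.range (d + 1) := Finset.mem_range.2 (by omega)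
  exact hN (f n) hle n ((Finset.le_sup hmem).trans hn) rfl

theorem infOften_sInf {f : ℕ → ℕ} (hb : ∃ C, ∀ n, f n ≤ C) :
    InfOften f (sInf {c | InfOften f c}) := by
  obtain ⟨C, hC⟩ := hb
  obtain ⟨c, -, hc⟩ := exists_infOften_le (f := f) (d := C) fun N => ⟨N, le_rfl, hC N⟩
  exact Nat.sInf_mem (s := {c | InfOften f c}) ⟨c, hc⟩

theorem sInf_infOften_le {f : ℕ → ℕ} {d : ℕ} (h : ∀ N, ∃ n, N ≤ n ∧ f n ≤ d) :
    sInf {c | InfOften f c} ≤ d := by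
  obtain ⟨c, hcd, hc⟩ := exists_infOften_le h
  exact (Nat.sInf_le (s := {c | InfOften f c}) hc).trans hcd

theorem eventually_sInf_infOften_le {f : ℕ → ℕ} :
    ∃ N, ∀ n, N ≤ n → sInf {c | InfOften f c} ≤ f n := by
  by_contra hc
  push Not at hc
  rcases Nat.eq_zero_or_pos (sInf {c | InfOften f c}) with h0 | hpos
  · obtain ⟨n, -, hn⟩ := hc 0
    omega
  · have := sInf_infOften_le (f := f) (d := sInf {c | InfOften f c} - 1) fun N => by
      obtain ⟨n, hn, hlt⟩ := hc N
      exact ⟨n, hn, by omega⟩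
    omega

theorem infOften_shift (f : ℕ → ℕ) (p c : ℕ) :
    InfOften (fun n => f (p + n)) c ↔ InfOften f c := by
  constructor
  · intro h N
    obtain ⟨n, hn, hc⟩ := h N
    exact ⟨p + n, by omega, hc⟩
  · intro h N
    obtain ⟨n, hn, hc⟩ := h (p + N)
    exact ⟨n - p, by omega, by simpa [show p + (n - p) = n by omega] using hc⟩

end InfinitelyOften

section Concatenation

theorem strictMono_of_blocks {ℓ f : ℕ → ℕ} (hf : ∀ n, f (n + 1) = f n + 1 + ℓ n) : StrictMono f :=
  strictMono_nat_of_lt_succ fun n => by rw [hf]; omega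

theorem exists_block_index {ℓ f : ℕ → ℕ} (h0 : f 0 = 0)
    (hf : ∀ n, f (n + 1) = f n + 1 + ℓ n) (m : ℕ) :
    ∃ n k, k ≤ ℓ n ∧ m = f n + k := by
  have hmono := strictMono_of_blocks hf
  set n := Nat.findGreatest (fun n => f n ≤ m) m with hn
  have h1 : f n ≤ m :=
    Nat.findGreatest_spec (P := fun n => f n ≤ m) (Nat.zero_le m) (by simp [h0])
  have h2 : m < f (n + 1) := by
    by_contra hlt
    push Not at hlt
    have := Nat.le_findGreatest (P := fun n => f n ≤ m) ((hmono.le_apply).trans hlt) hlt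
    omega
  rw [hf] at h2
  exact ⟨n, m - f n, by omega, by omega⟩

theorem block_index_unique {ℓ f : ℕ → ℕ} (hf : ∀ n, f (n + 1) = f n + 1 + ℓ n)
    {n k n' k' : ℕ} (hk : k ≤ ℓ n) (hk' : k' ≤ ℓ n') (h : f n + k = f n' + k') :
    n = n' ∧ k = k' := by
  have hmono := strictMono_of_blocks hf
  have key : n = n' := by
    rcases lt_trichotomy n n' with hlt | heq | hlt
    · have := hmono.monotone (Nat.succ_le_of_lt hlt)
      rw [Nat.succ_eq_add_one, hf] at this
      omega
    · exact heq
    · have := hmono.monotone (Nat.succ_le_of_lt hlt)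
      rw [Nat.succ_eq_add_one, hf] at this
      omega
  subst key
  exact ⟨rfl, by omega⟩

theorem exists_concat {A : Type v} (ℓ : ℕ → ℕ) (b : ℕ → ℕ → A) :
    ∃ (f : ℕ → ℕ) (w : ℕ → A), f 0 = 0 ∧ (∀ n, f (n + 1) = f n + 1 + ℓ n) ∧
      ∀ n k, k ≤ ℓ n → w (f n + k) = b n k := by
  let f : ℕ → ℕ := fun n => Nat.rec 0 (fun n r => r + 1 + ℓ n) n
  have h0 : f 0 = 0 := rfl
  have hf : ∀ n, f (n + 1) = f n + 1 + ℓ n := fun n => rfl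
  choose N K hK hm using exists_block_index h0 hf
  refine ⟨f, fun m => b (N m) (K m), h0, hf, fun n k hk => ?_⟩
  obtain ⟨h1, h2⟩ := block_index_unique hf hk (hK (f n + k)) (hm (f n + k))
  simp only [← h1, ← h2]

end Concatenation

namespace DPA

variable {Q : Type u} {A : Type v}

theorem runFrom_add (M : DPA Q A) (q : Q) (w : ℕ → A) (a k : ℕ) :
    M.runFrom q w (a + k) = M.runFrom (M.runFrom q w a) (fun i => w (a + i)) k := by
  induction k with
  | zero => rfl
  | succ k ih => rw [← Nat.add_assoc, runFrom, runFrom, ih]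

theorem runFrom_congr (M : DPA Q A) (q : Q) {w w' : ℕ → A} {n : ℕ}
    (h : ∀ k < n, w k = w' k) : M.runFrom q w n = M.runFrom q w' n := by
  induction n with
  | zero => rfl
  | succ n ih => rw [runFrom, runFrom, ih fun k hk => h k (by omega), h n (by omega)]

theorem path_add (M : DPA Q A) {w : ℕ → A} {σ : ℕ → Q} {p : ℕ}
    (h : ∀ n, p ≤ n → σ (n + 1) = M.trans (σ n) (w n)) {a : ℕ} (ha : p ≤ a) (k : ℕ) :
    σ (a + k) = M.runFrom (σ a) (fun i => w (a + i)) k := by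
  induction k with
  | zero => rfl
  | succ k ih => rw [← Nat.add_assoc, h _ (by omega), runFrom, ih]

theorem exists_color_bound [Fintype Q] [Fintype A] (M : DPA Q A) :
    ∃ C, ∀ q x, M.color q x ≤ C :=
  ⟨M.maxColor, fun q x =>
    Finset.le_sup (f := fun t : Q × A => M.color t.1 t.2) (Finset.mem_univ (q, x))⟩

theorem domColorFrom_runFrom (M : DPA Q A) (q : Q) (w : ℕ → A) (p : ℕ) :
    M.domColorFrom (M.runFrom q w p) (fun k => w (p + k)) = M.domColorFrom q w := by
  have : M.colorsFrom (M.runFrom q w p) (fun k => w (p + k)) =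
      fun n => M.colorsFrom q w (p + n) := by
    funext n
    simp only [colorsFrom, runFrom_add]
  simp only [domColorFrom, this, infOften_shift]

theorem mem_langFrom_runFrom (M : DPA Q A) (q : Q) (w : ℕ → A) (p : ℕ) :
    (fun k => w (p + k)) ∈ M.langFrom (M.runFrom q w p) ↔ w ∈ M.langFrom q := by
  simp only [langFrom, acceptsFrom, Set.mem_ofPred_eq, domColorFrom_runFrom]

theorem LangEquiv.trans_letter {M : DPA Q A} {q q' : Q} (h : M.LangEquiv q q') (x : A) :
    M.LangEquiv (M.trans q x) (M.trans q' x) := by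
  have key : ∀ (r : Q) (w : ℕ → A), w ∈ M.langFrom (M.trans r x) ↔
      (fun n => Nat.casesOn n x w : ℕ → A) ∈ M.langFrom r := by
    intro r w
    rw [← M.mem_langFrom_runFrom r _ 1]
    simp only [Nat.add_comm 1]
    rfl
  ext w
  rw [key, key, h]

theorem LangEquiv.runFrom {M : DPA Q A} {q q' : Q} (h : M.LangEquiv q q') (w : ℕ → A) (n : ℕ) :
    M.LangEquiv (M.runFrom q w n) (M.runFrom q' w n) := by
  induction n with
  | zero => exact h
  | succ n ih => exact ih.trans_letter (w n)

section Coruns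

variable {M : DPA Q A} {w : ℕ → A}

theorem path_langEquiv {σ : ℕ → Q} {p : ℕ} (he : M.LangEquiv (σ p) (M.runFrom M.init w p))
    (h : ∀ n, p ≤ n → σ (n + 1) = M.trans (σ n) (w n)) {n : ℕ} (hn : p ≤ n) :
    M.LangEquiv (σ n) (M.runFrom M.init w n) := by
  obtain ⟨k, rfl⟩ := Nat.exists_eq_add_of_le hn
  rw [path_add M h le_rfl, runFrom_add]
  exact he.runFrom _ _

theorem even_coRunDom_iff {σ : ℕ → Q} (hσ : M.IsCoRun w σ) :
    Even (M.coRunDom w σ) ↔ w ∈ M.lang := by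
  obtain ⟨p, -, -, he, hs⟩ := hσ
  have h1 : M.coRunDom w σ = M.domColorFrom (σ p) (fun k => w (p + k)) := by
    have : M.colorsFrom (σ p) (fun k => w (p + k)) =
        fun n => (fun n => M.color (σ n) (w n)) (p + n) := by
      funext n
      simp only [colorsFrom, path_add M hs le_rfl]
    rw [coRunDom, domColorFrom, this]
    simp only [infOften_shift (fun n => M.color (σ n) (w n))]
  rw [h1, lang, ← M.mem_langFrom_runFrom M.init w p, ← he]
  rfl

/-- The run up to position `p`, continued from `q` afterwards. -/
noncomputable def splice (M : DPA Q A) (w : ℕ → A) (p : ℕ) (q : Q) (m : ℕ) : Q :=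
  if m < p then M.runFrom M.init w m else M.runFrom q (fun k => w (p + k)) (m - p)

theorem splice_add (M : DPA Q A) (w : ℕ → A) (p : ℕ) (q : Q) (k : ℕ) :
    M.splice w p q (p + k) = M.runFrom q (fun k => w (p + k)) k := by
  simp [splice]

theorem splice_self (M : DPA Q A) (w : ℕ → A) (p : ℕ) (q : Q) : M.splice w p q p = q :=
  M.splice_add w p q 0

theorem splice_succ (M : DPA Q A) (w : ℕ → A) (p : ℕ) (q : Q) {n : ℕ} (hn : p ≤ n) :
    M.splice w p q (n + 1) = M.trans (M.splice w p q n) (w n) := by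
  obtain ⟨k, rfl⟩ := Nat.exists_eq_add_of_le hn
  rw [Nat.add_assoc, splice_add, splice_add, DPA.runFrom]

theorem isCoRun_splice {p : ℕ} (hp : 0 < p) {q : Q}
    (h : M.LangEquiv q (M.runFrom M.init w p)) : M.IsCoRun w (M.splice w p q) :=
  ⟨p, hp, fun n hn => by simp [splice, hn], by rwa [splice_self],
    fun n hn => M.splice_succ w p q hn⟩

/-- The dominating colors of the co-runs on `w`. -/
def coRunColors (M : DPA Q A) (w : ℕ → A) : Set ℕ :=
  {d | ∃ σ : ℕ → Q, M.IsCoRun w σ ∧ M.coRunDom w σ = d}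

theorem exists_isGreatest_coRunColors [Fintype Q] [Fintype A] (M : DPA Q A) (w : ℕ → A) :
    ∃ d, IsGreatest (M.coRunColors w) d := by
  obtain ⟨C, hC⟩ := M.exists_color_bound
  have hb : C ∈ upperBounds (M.coRunColors w) := by
    rintro d ⟨σ, -, rfl⟩
    exact sInf_infOften_le fun N => ⟨N, le_rfl, hC _ _⟩
  have hne : (M.coRunColors w).Nonempty :=
    ⟨_, M.splice w 1 (M.runFrom M.init w 1), isCoRun_splice one_pos rfl, rfl⟩
  exact ⟨sSup (M.coRunColors w), Nat.sSup_mem hne ⟨C, hb⟩, fun d hd => le_csSup ⟨C, hb⟩ hd⟩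

end Coruns

theorem exists_window [Fintype Q] {M : DPA Q A} {w : ℕ → A} {d : ℕ}
    (hd : ∀ σ, M.IsCoRun w σ → ∀ N, ∃ n, N ≤ n ∧ M.color (σ n) (w n) ≤ d) {a : ℕ} (ha : 0 < a) :
    ∃ b, a < b ∧ ∀ q, M.LangEquiv q (M.runFrom M.init w a) →
      ∃ k, a + k < b ∧ M.colorsFrom q (fun k => w (a + k)) k ≤ d := by
  have : ∀ q, ∃ k, M.LangEquiv q (M.runFrom M.init w a) →
      M.colorsFrom q (fun k => w (a + k)) k ≤ d := by
    intro q
    by_cases hq : M.LangEquiv q (M.runFrom M.init w a)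
    · obtain ⟨n, hn, hle⟩ := hd _ (isCoRun_splice ha hq) a
      obtain ⟨k, rfl⟩ := Nat.exists_eq_add_of_le hn
      rw [splice_add] at hle
      exact ⟨k, fun _ => hle⟩
    · exact ⟨0, fun h => absurd h hq⟩
  choose K hK using this
  refine ⟨a + Finset.univ.sup K + 1, by omega, fun q hq => ⟨K q, ?_, hK q hq⟩⟩
  have := Finset.le_sup (f := K) (Finset.mem_univ q)
  omega

theorem runList_seg (M : DPA Q A) (q : Q) (w : ℕ → A) (a b : ℕ) :
    M.runList q (seg w a b) = M.runFrom q (fun k => w (a + k)) (b - a) := by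
  rw [seg]
  induction b - a with
  | zero => rfl
  | succ n ih =>
    rw [List.range_succ, List.map_append, DPA.runFrom, ← ih]
    simp [runList]

theorem runList_prefixList (M : DPA Q A) (q : Q) (w : ℕ → A) (n : ℕ) :
    M.runList q (prefixList w n) = M.runFrom q w n := by
  simpa [seg, prefixList] using M.runList_seg q w 0 n

section SuffixLanguages

variable [Inhabited A]

theorem suffixLang_langFrom (M : DPA Q A) (q : Q) (u : List A) :
    suffixLang (M.langFrom q) u = M.langFrom (M.runList q u) := by
  ext w
  have hrun : ∀ u' : List A, (∀ k (hk : k < u'.length), listApp u w k = u'[k]) →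
      M.runFrom q (listApp u w) u'.length = M.runList q u' := by
    intro u'
    induction u' using List.reverseRecOn with
    | nil => intro _; rfl
    | append_singleton l x ih =>
      intro h
      have hx := h l.length (by simp)
      rw [List.length_append, List.length_singleton, DPA.runFrom, ih, hx]
      · simp [runList]
      · intro k hk
        rw [h k (by simp; omega), List.getElem_append_left hk]
  rw [← hrun u fun k hk => by simp [listApp, hk]]
  change listApp u w ∈ M.langFrom q ↔ _
  rw [← M.mem_langFrom_runFrom q (listApp u w) u.length]
  simp [listApp]

theorem suffixInv_lang_iff (M : DPA Q A) (w w' : ℕ → A) (n a b : ℕ) :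
    SuffixInv M.lang (seg w' a b) (prefixList w n) ↔
      M.LangEquiv (M.runFrom M.init w n)
        (M.runFrom (M.runFrom M.init w n) (fun k => w' (a + k)) (b - a)) := by
  have : M.runList M.init (prefixList w n ++ seg w' a b) =
      M.runFrom (M.runFrom M.init w n) (fun k => w' (a + k)) (b - a) := by
    rw [← runList_seg, ← runList_prefixList]
    simp [runList]
  rw [SuffixInv, lang, suffixLang_langFrom, suffixLang_langFrom, runList_prefixList, this,
    LangEquiv]

theorem langEquiv_of_injection {M : DPA Q A} {w w' : ℕ → A} {J : Set ℕ} {f : ℕ → ℕ}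
    (h0 : f 0 = 0) (hw : ∀ n, w' (f n) = w n) (hJ' : ∀ n, n ∉ J → f (n + 1) = f n + 1)
    (hJ : ∀ n, n ∈ J → f n < f (n + 1) ∧
      SuffixInv M.lang (seg w' (f n + 1) (f (n + 1))) (prefixList w (n + 1))) (n : ℕ) :
    M.LangEquiv (M.runFrom M.init w' (f n)) (M.runFrom M.init w n) := by
  induction n with
  | zero => rw [h0]; rfl
  | succ n ih =>
    have h1 : M.LangEquiv (M.runFrom M.init w' (f n + 1)) (M.runFrom M.init w (n + 1)) := by
      rw [DPA.runFrom, DPA.runFrom, hw]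
      exact ih.trans_letter _
    by_cases hn : n ∈ J
    · obtain ⟨hlt, hinv⟩ := hJ n hn
      rw [suffixInv_lang_iff] at hinv
      have h2 := h1.runFrom (fun k => w' (f n + 1 + k)) (f (n + 1) - (f n + 1))
      rw [← runFrom_add, show f n + 1 + (f (n + 1) - (f n + 1)) = f (n + 1) by omega] at h2
      exact h2.trans hinv.symm
    · rwa [hJ' n hn]

theorem isInj_self (L : Set (ℕ → A)) (w : ℕ → A) (J : Set ℕ) : IsInj L w J w :=
  ⟨id, rfl, fun _ => rfl, fun _ _ => rfl, fun n _ => ⟨n.lt_succ_self, by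
    simp [SuffixInv, seg]⟩⟩

theorem exists_sparse_positions [Fintype Q] {M : DPA Q A} {w : ℕ → A} {d : ℕ}
    (hd : ∀ σ, M.IsCoRun w σ → ∀ N, ∃ n, N ≤ n ∧ M.color (σ n) (w n) ≤ d) :
    ∃ J : Set ℕ, J.Infinite ∧ ∀ w', IsInj M.lang w J w' →
      ∀ σ, M.IsCoRun w' σ → ∀ N, ∃ n, N ≤ n ∧ M.color (σ n) (w' n) ≤ d := by
  choose! b hab hb using fun (a : ℕ) (ha : 0 < a) => exists_window hd ha
  let j : ℕ → ℕ := fun k => Nat.rec 0 (fun _ r => b (r + 1)) k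
  have hj : ∀ k, j (k + 1) = b (j k + 1) := fun k => rfl
  have hmono : StrictMono j := strictMono_nat_of_lt_succ fun k => by
    have := hab (j k + 1) (by omega)
    rw [hj]; omega
  refine ⟨Set.range j, Set.infinite_range_of_injective hmono.injective, ?_⟩
  rintro w' ⟨f, h0, hw, hJ', hJ⟩ σ ⟨p, hp, -, he, hs⟩ N
  have hfmono : StrictMono f := strictMono_nat_of_lt_succ fun n => by
    by_cases hn : n ∈ Set.range j
    · exact (hJ n hn).1
    · rw [hJ' n hn]; omega
  set k := p + N with hk
  set a := j k + 1 with ha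
  have hfa : p + N ≤ f a := by
    have h1 : k ≤ j k := hmono.le_apply
    have h2 : a ≤ f a := hfmono.le_apply
    omega
  have hq : M.LangEquiv (σ (f a)) (M.runFrom M.init w a) :=
    (path_langEquiv he hs (by omega)).trans (langEquiv_of_injection h0 hw hJ' hJ a)
  obtain ⟨i, hi, hle⟩ := hb a (by omega) _ hq
  have hcontig : ∀ i, a + i < j (k + 1) → f (a + i) = f a + i := by
    intro i
    induction i with
    | zero => intro _; rfl
    | succ i ih =>
      intro hlt
      rw [← Nat.add_assoc, hJ', ih (by omega), Nat.add_assoc]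
      rintro ⟨k', hk'⟩
      have h1 : k < k' := hmono.lt_iff_lt.1 (by omega)
      have h2 : k' < k + 1 := hmono.lt_iff_lt.1 (by omega)
      omega
  rw [← hj] at hi
  refine ⟨f a + i, by omega, ?_⟩
  have hletters : ∀ l, a + l < j (k + 1) → w (a + l) = w' (f a + l) := fun l hl => by
    rw [← hcontig l hl, hw]
  rw [path_add M hs (by omega), ← hletters i hi]
  rw [colorsFrom, runFrom_congr M _ (w' := fun i => w' (f a + i))
    fun l hl => hletters l (by omega)] at hle
  exact hle

theorem atHome_of_isGreatest [Fintype Q] [Fintype A] (M : DPA Q A) (d : ℕ) :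
    ∀ w, IsGreatest (M.coRunColors w) d → AtHome M.lang d w := by
  induction d using Nat.strong_induction_on with
  | _ d ih =>
    intro w hd
    obtain ⟨C, hC⟩ := M.exists_color_bound
    have hcol : ∀ σ, M.IsCoRun w σ → ∀ N, ∃ n, N ≤ n ∧ M.color (σ n) (w n) ≤ d := by
      intro σ hσ N
      obtain ⟨n, hn, h⟩ :=
        infOften_sInf (f := fun n => M.color (σ n) (w n)) ⟨C, fun n => hC _ _⟩ N
      exact ⟨n, hn, h.trans_le (hd.2 ⟨σ, hσ, rfl⟩)⟩
    obtain ⟨J, hJ, hinj⟩ := exists_sparse_positions hcol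
    rw [AtHome]
    refine ⟨J, hJ, fun w' hw' => ?_⟩
    obtain ⟨d', hd'⟩ := M.exists_isGreatest_coRunColors w'
    obtain ⟨σ, hσ, hdom⟩ := hd.1
    obtain ⟨σ', hσ', hdom'⟩ := hd'.1
    have hle : d' ≤ d := hdom' ▸ sInf_infOften_le (hinj w' hw' σ' hσ')
    rcases hle.lt_or_eq with hlt | rfl
    · exact Or.inl ⟨d', hlt, ih d' hlt w' hd'⟩
    · have h1 := even_coRunDom_iff hσ
      have h2 := even_coRunDom_iff hσ'
      rw [hdom] at h1
      rw [hdom'] at h2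
      rcases Nat.even_or_odd d' with he | ho
      · exact Or.inr (Or.inl ⟨h1.1 he, h2.1 he, he⟩)
      · have hne := Nat.not_even_iff_odd.2 ho
        exact Or.inr (Or.inr ⟨fun h => hne (h1.2 h), fun h => hne (h2.2 h), ho⟩)

end SuffixLanguages

/-- Every transition of positive color at least `c` starts at a state with a loop of least
color `c`. -/
def HasLoops (M : DPA Q A) : Prop :=
  ∀ c, 0 < c → ∀ q x, c ≤ M.color q x → ∃ (ℓ : ℕ) (v : ℕ → A), M.runFrom q v ℓ = q ∧
    (∀ k < ℓ, c ≤ M.colorsFrom q v k) ∧ ∃ k < ℓ, M.colorsFrom q v k = c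

section Lowering

variable [Inhabited A]

theorem exists_isInj_coRunDom_eq {M : DPA Q A} (hM : M.HasLoops)
    {w : ℕ → A} {σ : ℕ → Q} (hσ : M.IsCoRun w σ) {J : Set ℕ} (hJ : J.Infinite) {c : ℕ}
    (hc : 0 < c) (hdom : c ≤ M.coRunDom w σ) :
    ∃ w' σ', IsInj M.lang w J w' ∧ M.IsCoRun w' σ' ∧ M.coRunDom w' σ' = c := by
  obtain ⟨p, hp, -, he, hs⟩ := hσ
  obtain ⟨N₀, hN₀⟩ := eventually_sInf_infOften_le (f := fun n => M.color (σ n) (w n))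
  set N := max p N₀ with hN
  have hpN : p ≤ N := le_max_left _ _
  have hcol : ∀ n, N ≤ n → c ≤ M.color (σ n) (w n) := fun n hn =>
    hdom.trans (hN₀ n ((le_max_right _ _).trans hn))
  have hex : ∀ n, ∃ (ℓ : ℕ) (v : ℕ → A),
      (n ∈ J ∧ N ≤ n → ∃ k < ℓ, M.colorsFrom (σ (n + 1)) v k = c) ∧
      (¬ (n ∈ J ∧ N ≤ n) → ℓ = 0) ∧
      M.runFrom (σ (n + 1)) v ℓ = σ (n + 1) ∧
      ∀ k < ℓ, c ≤ M.colorsFrom (σ (n + 1)) v k := by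
    intro n
    by_cases hn : n ∈ J ∧ N ≤ n
    · obtain ⟨ℓ, v, h1, h2, h3⟩ := hM c hc _ _ (hcol (n + 1) (by omega))
      exact ⟨ℓ, v, fun _ => h3, fun h => absurd hn h, h1, h2⟩
    · exact ⟨0, w, fun h => absurd h hn, fun _ => rfl, rfl, fun k hk => absurd hk (by omega)⟩
  choose ℓ v hv hℓ hloop hge using hex
  obtain ⟨f, w', h0, hf, hw'⟩ := exists_concat ℓ 
    fun n k => (Nat.casesOn k (w n) (v n) : A)
  have hwf : ∀ n, w' (f n) = w n := fun n => hw' n 0 (Nat.zero_le _)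
  have hwv : ∀ n k, k < ℓ n → w' (f n + 1 + k) = v n k := fun n k hk => by
    rw [Nat.add_assoc, Nat.add_comm 1 k]
    exact hw' n (k + 1) (by omega)
  have hfid : ∀ n, n ≤ N → f n = n := by
    intro n
    induction n with
    | zero => intro _; exact h0
    | succ n ih =>
      intro hn
      rw [hf, ih (by omega), hℓ n (by omega)]
  have hrunN : M.runFrom M.init w' N = M.runFrom M.init w N :=
    M.runFrom_congr _ fun k hk => by rw [← hwf k, hfid k hk.le]
  have hequiv : ∀ n, N ≤ n → M.LangEquiv (σ n) (M.runFrom M.init w n) := fun n hn =>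
    path_langEquiv he hs (hpN.trans hn)
  set σ' := M.splice w' N (σ N) with hσ'
  have hs' : ∀ n, N ≤ n → σ' (n + 1) = M.trans (σ' n) (w' n) := fun n hn =>
    M.splice_succ w' N (σ N) hn
  have hfge : ∀ n, n ≤ f n := fun n => (strictMono_of_blocks hf).le_apply
  have hblock : ∀ n, N ≤ n → σ' (f n) = σ n → ∀ k ≤ ℓ n,
      σ' (f n + 1 + k) = M.runFrom (σ (n + 1)) (v n) k := by
    intro n hn hfn k hk
    have := hfge n
    rw [path_add M hs' (by omega), hs' _ (by omega), hfn, hwf, ← hs n (by omega)]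
    exact M.runFrom_congr _ fun i hi => hwv n i (by omega)
  have hsync : ∀ n, N ≤ n → σ' (f n) = σ n := by
    intro n hn
    induction n, hn using Nat.le_induction with
    | base => rw [hfid N le_rfl]; exact M.splice_self w' N (σ N)
    | succ n hn ih => rw [hf, hblock n hn ih _ le_rfl, hloop]
  refine ⟨w', σ', ⟨f, h0, hwf, ?_, ?_⟩, isCoRun_splice (by omega) ?_, ?_⟩
  · intro n hn
    rw [hf, hℓ n fun h => hn h.1]
  · intro n hn
    refine ⟨by rw [hf]; omega, ?_⟩
    rw [suffixInv_lang_iff, hf, Nat.add_sub_cancel_left,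
      M.runFrom_congr (w' := v n) _ fun k hk => hwv n k hk]
    by_cases hNn : N ≤ n
    · have h1 := hequiv (n + 1) (by omega)
      have h2 := h1.runFrom (v n) (ℓ n)
      rw [hloop] at h2
      exact h1.symm.trans h2
    · rw [hℓ n fun h => hNn h.2]
      rfl
  · rw [hrunN]
    exact hequiv N le_rfl
  · have hinf : ∀ K, ∃ m, K ≤ m ∧ M.color (σ' m) (w' m) = c := by
      intro K
      obtain ⟨n, hn, hlt⟩ := hJ.exists_gt (max N K)
      have hNn : N ≤ n := (le_max_left _ _).trans hlt.le
      have hKn : K ≤ n := (le_max_right _ _).trans hlt.le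
      obtain ⟨k, hk, hkc⟩ := hv n ⟨hn, hNn⟩
      have := hfge n
      refine ⟨f n + 1 + k, by omega, ?_⟩
      rw [hblock n hNn (hsync n hNn) k hk.le, hwv n k hk]
      exact hkc
    have hlow : ∀ m, N ≤ m → c ≤ M.color (σ' m) (w' m) := by
      intro m hm
      obtain ⟨n, k, hk, rfl⟩ := exists_block_index h0 hf m
      have hNn : N ≤ n := by
        by_contra hlt
        rw [hfid n (by omega)] at hm
        rw [hℓ n fun h => hlt h.2] at hk
        omega
      rcases k with _ | k
      · rw [Nat.add_zero, hsync n hNn, hwf]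
        exact hcol n hNn
      · rw [Nat.add_comm k 1, ← Nat.add_assoc, hblock n hNn (hsync n hNn) k (by omega),
          hwv n k (by omega)]
        exact hge n k (by omega)
    refine le_antisymm (Nat.sInf_le hinf) ?_
    refine le_csInf ⟨c, hinf⟩ fun c' hc' => ?_
    obtain ⟨m, hm, rfl⟩ := hc' N
    exact hlow m hm

theorem coRunDom_le_of_atHome {M : DPA Q A} (hM : M.HasLoops) (i : ℕ) :
    ∀ w, AtHome M.lang i w → ∀ σ, M.IsCoRun w σ → M.coRunDom w σ ≤ i := by
  induction i using Nat.strong_induction_on with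
  | _ i ih =>
    intro w hw σ hσ
    by_contra hlt
    push Not at hlt
    rw [AtHome] at hw
    obtain ⟨J, hJ, hinj⟩ := hw
    have key : ∃ w' σ', IsInj M.lang w J w' ∧ M.IsCoRun w' σ' ∧ i < M.coRunDom w' σ' ∧
        ¬ (Even (M.coRunDom w' σ') ↔ Even i) := by
      by_cases hpar : Even (M.coRunDom w σ) ↔ Even i
      · have hd : i + 1 < M.coRunDom w σ := by
          rcases (Nat.succ_le_of_lt hlt).lt_or_eq with h | h
          · exact h
          · rw [← h, Nat.succ_eq_add_one, Nat.even_add_one] at hpar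
            tauto
        obtain ⟨w', σ', h1, h2, h3⟩ := exists_isInj_coRunDom_eq hM hσ hJ
          (c := i + 1) (by omega) hd.le
        exact ⟨w', σ', h1, h2, by omega, by rw [h3, Nat.even_add_one]; tauto⟩
      · exact ⟨w, σ, isInj_self _ _ _, hσ, hlt, hpar⟩
    obtain ⟨w', σ', h1, h2, h3, h4⟩ := key
    rw [even_coRunDom_iff h2] at h4
    rcases hinj w' h1 with ⟨i', hi', hat⟩ | ⟨-, h, he⟩ | ⟨-, h, ho⟩
    · have := ih i' hi' w' hat σ' h2
      omega
    · exact h4 ⟨fun _ => he, fun _ => h⟩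
    · exact h4 ⟨fun h' => absurd h' h, fun he => absurd he (Nat.not_even_iff_odd.2 ho)⟩

end Lowering

section Streamlining

variable {M : DPA Q A}

theorem SameSCC.symm {G : Set (Q × A)} {a b : Q} (h : M.SameSCC G a b) : M.SameSCC G b a :=
  ⟨h.2, h.1⟩

theorem SameSCC.trans {G : Set (Q × A)} {a b c : Q} (h : M.SameSCC G a b)
    (h' : M.SameSCC G b c) : M.SameSCC G a c :=
  ⟨Relation.ReflTransGen.trans h.1 h'.1, Relation.ReflTransGen.trans h'.2 h.2⟩

theorem sccMinCol_congr {G : Set (Q × A)} {col : Q × A → ℕ} {a b : Q} (h : M.SameSCC G a b) :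
    M.sccMinCol G col a = M.sccMinCol G col b := by
  have : ∀ r, M.SameSCC G r a ↔ M.SameSCC G r b := fun r =>
    ⟨fun h' => h'.trans h, fun h' => h'.trans h.symm⟩
  simp only [sccMinCol, this]

theorem streamStep_cases (M : DPA Q A) (s : SState Q A) :
    (∃ D ⊆ s.graph, M.streamStep s =
      ⟨s.graph \ D, fun t => if t ∈ D then s.counter else s.col t, s.counter⟩) ∨
    (M.streamStep s = ⟨s.graph, s.col, s.counter + 1⟩ ∧ s.graph ≠ ∅ ∧
      (∀ t ∈ s.graph, ¬ M.Transient s.graph t) ∧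
      ∀ t ∈ s.graph, M.SameSCC s.graph t.1 (M.trans t.1 t.2) →
        s.col t = M.sccMinCol s.graph s.col t.1 → s.col t % 2 ≠ s.counter % 2) := by
  unfold streamStep
  split_ifs with h0
  · exact Or.inl ⟨∅, Set.empty_subset _, by simp⟩
  · dsimp only
    split_ifs with h1 h2
    · exact Or.inl ⟨{t ∈ s.graph | M.Transient s.graph t}, fun _ ht => ht.1, by congr!⟩
    · exact Or.inl ⟨{t ∈ s.graph | M.SameSCC s.graph t.1 (M.trans t.1 t.2) ∧
        s.col t = M.sccMinCol s.graph s.col t.1 ∧ s.col t % 2 = s.counter % 2},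
        fun _ ht => ht.1, by congr!⟩
    · refine Or.inr ⟨rfl, h0, fun t ht htr => ?_, fun t ht h3 h4 h5 => ?_⟩
      · exact h1 (Set.nonempty_iff_ne_empty.1 ⟨t, ht, htr⟩)
      · exact h2 (Set.nonempty_iff_ne_empty.1 ⟨t, ht, h3, h4, h5⟩)

theorem streamStep_removes {s : SState Q A}
    (hT : ∀ t ∈ s.graph, ¬ M.Transient s.graph t)
    (hR : ∀ t ∈ s.graph, M.SameSCC s.graph t.1 (M.trans t.1 t.2) →
      s.col t = M.sccMinCol s.graph s.col t.1 → s.col t % 2 = s.counter % 2)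
    {t : Q × A} (ht : t ∈ s.graph) :
    ∃ e ∈ s.graph, M.SameSCC s.graph e.1 t.1 ∧ M.SameSCC s.graph (M.trans e.1 e.2) t.1 ∧
      e ∉ (M.streamStep s).graph ∧ (M.streamStep s).col e = s.counter := by
  have hself : M.SameSCC s.graph (M.trans t.1 t.2) t.1 :=
    ⟨not_not.1 (hT t ht), Relation.ReflTransGen.single ⟨t.2, ht, rfl⟩⟩
  obtain ⟨p, x, hpx, h1, h2, h3⟩ := Nat.sInf_mem (s := {c | ∃ p x, (p, x) ∈ s.graph ∧
    M.SameSCC s.graph p t.1 ∧ M.SameSCC s.graph (M.trans p x) t.1 ∧ s.col (p, x) = c})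
    ⟨s.col t, t.1, t.2, ht, ⟨.refl, .refl⟩, hself, rfl⟩
  have h4 : M.SameSCC s.graph p (M.trans p x) := h1.trans h2.symm
  have h5 : s.col (p, x) = M.sccMinCol s.graph s.col p := by
    rw [sccMinCol_congr h1]
    exact h3
  let R := {t ∈ s.graph | M.SameSCC s.graph t.1 (M.trans t.1 t.2) ∧
    s.col t = M.sccMinCol s.graph s.col t.1 ∧ s.col t % 2 = s.counter % 2}
  have hmem : (p, x) ∈ R := ⟨hpx, h4, h5, hR _ hpx h4 h5⟩
  have hTe : {t ∈ s.graph | M.Transient s.graph t} = ∅ :=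
    Set.eq_empty_of_forall_notMem fun t ht => hT t ht.1 ht.2
  have hstep : M.streamStep s = ⟨s.graph \ R, fun t => if t ∈ R then s.counter else s.col t,
      s.counter⟩ := by
    unfold streamStep
    rw [if_neg (Set.nonempty_iff_ne_empty.1 ⟨t, ht⟩)]
    dsimp only
    rw [if_neg (not_not.2 hTe), if_pos (Set.nonempty_iff_ne_empty.1 ⟨_, hmem⟩)]
  refine ⟨(p, x), hpx, h1, h2, ?_, ?_⟩
  · rw [hstep]
    exact fun h => h.2 hmem
  · rw [hstep]
    exact if_pos hmem

theorem streamRun_succ (M : DPA Q A) (m : ℕ) :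
    M.streamRun (m + 1) = M.streamStep (M.streamRun m) :=
  Function.iterate_succ_apply' _ _ _

theorem streamRun_removed {m : ℕ} {t : Q × A} (ht : t ∉ (M.streamRun m).graph) {n : ℕ}
    (hn : m ≤ n) :
    t ∉ (M.streamRun n).graph ∧ (M.streamRun n).col t = (M.streamRun m).col t := by
  induction n, hn using Nat.le_induction with
  | base => exact ⟨ht, rfl⟩
  | succ n hn ih =>
    rw [streamRun_succ]
    rcases M.streamStep_cases (M.streamRun n) with ⟨D, hD, h⟩ | ⟨h, -⟩
    · rw [h]
      exact ⟨fun h' => ih.1 h'.1, (if_neg fun h' => ih.1 (hD h')).trans ih.2⟩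
    · rw [h]
      exact ih

theorem streamRun_col_le_counter (m : ℕ) (t : Q × A) (ht : t ∉ (M.streamRun m).graph) :
    (M.streamRun m).col t ≤ (M.streamRun m).counter := by
  induction m with
  | zero => exact absurd (Set.mem_univ t) ht
  | succ m ih =>
    rw [streamRun_succ] at ht ⊢
    rcases M.streamStep_cases (M.streamRun m) with ⟨D, hD, h⟩ | ⟨h, -⟩
    · rw [h] at ht ⊢
      by_cases htD : t ∈ D
      · exact (if_pos htD).le
      · exact (if_neg htD).trans_le (ih fun h' => ht ⟨h', htD⟩)
    · rw [h] at ht ⊢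
      exact (ih ht).trans (Nat.le_succ _)

theorem streamRun_counter_le_col {m : ℕ} (t : Q × A) {n : ℕ} (hn : m ≤ n)
    (ht : t ∈ (M.streamRun m).graph) :
    (M.streamRun m).counter ≤ (M.streamRun n).counter ∧
      (t ∈ (M.streamRun n).graph ∨ (M.streamRun m).counter ≤ (M.streamRun n).col t) := by
  induction n, hn using Nat.le_induction with
  | base => exact ⟨le_rfl, Or.inl ht⟩
  | succ n hn ih =>
    rw [streamRun_succ]
    rcases M.streamStep_cases (M.streamRun n) with ⟨D, hD, h⟩ | ⟨h, -⟩
    · rw [h]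
      refine ⟨ih.1, ?_⟩
      by_cases htD : t ∈ D
      · exact Or.inr (ih.1.trans (if_pos htD).ge)
      · exact ih.2.imp (fun h' => ⟨h', htD⟩) fun h' => h'.trans (if_neg htD).ge
    · rw [h]
      exact ⟨ih.1.trans (Nat.le_succ _), ih.2⟩

theorem exists_streamStep_increment {n c : ℕ} (hc : 0 < c)
    (hn : c ≤ (M.streamRun n).counter) :
    ∃ m < n, (M.streamRun m).counter + 1 = c ∧
      M.streamStep (M.streamRun m) =
        ⟨(M.streamRun m).graph, (M.streamRun m).col, (M.streamRun m).counter + 1⟩ ∧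
      (∀ t ∈ (M.streamRun m).graph, ¬ M.Transient (M.streamRun m).graph t) ∧
      ∀ t ∈ (M.streamRun m).graph,
        M.SameSCC (M.streamRun m).graph t.1 (M.trans t.1 t.2) →
        (M.streamRun m).col t = M.sccMinCol (M.streamRun m).graph (M.streamRun m).col t.1 →
        (M.streamRun m).col t % 2 ≠ (M.streamRun m).counter % 2 := by
  induction n with
  | zero => exact absurd hn (by
      simp only [streamRun, Function.iterate_zero, id_eq]
      omega)
  | succ n ih =>
    by_cases hlt : c ≤ (M.streamRun n).counter
    · obtain ⟨m, hm, h⟩ := ih hlt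
      exact ⟨m, by omega, h⟩
    · rw [streamRun_succ] at hn
      rcases M.streamStep_cases (M.streamRun n) with ⟨D, hD, h⟩ | ⟨h, -, h1, h2⟩
      · rw [h] at hn
        exact absurd hn hlt
      · have h3 := hn
        rw [h] at h3
        dsimp only at h3
        exact ⟨n, by omega, by omega, h, h1, h2⟩

theorem path_extend_edge {G : Set (Q × A)} {a : Q} {ℓ : ℕ} {v : ℕ → A}
    (hv : ∀ k < ℓ, (M.runFrom a v k, v k) ∈ G) {x : A} (hx : (M.runFrom a v ℓ, x) ∈ G) :
    ∃ v' : ℕ → A, (∀ k < ℓ, v' k = v k) ∧ v' ℓ = x ∧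
      (∀ k ≤ ℓ, M.runFrom a v' k = M.runFrom a v k) ∧
      ∀ k < ℓ + 1, (M.runFrom a v' k, v' k) ∈ G := by
  have h1 : ∀ k < ℓ, Function.update v ℓ x k = v k := fun k hk =>
    Function.update_of_ne hk.ne _ _
  have h2 : ∀ k ≤ ℓ, M.runFrom a (Function.update v ℓ x) k = M.runFrom a v k := fun k hk =>
    M.runFrom_congr a fun i hi => h1 i (hi.trans_le hk)
  refine ⟨Function.update v ℓ x, h1, Function.update_self .., h2, fun k hk => ?_⟩
  rcases (Nat.le_of_lt_succ hk).lt_or_eq with hlt | rfl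
  · rw [h1 k hlt, h2 k hlt.le]
    exact hv k hlt
  · rwa [h2 _ le_rfl, Function.update_self]

theorem path_extend {G : Set (Q × A)} {a b c : Q} {ℓ : ℕ} {v : ℕ → A}
    (hb : M.runFrom a v ℓ = b) (hv : ∀ k < ℓ, (M.runFrom a v k, v k) ∈ G)
    (hr : M.reachIn G b c) :
    ∃ ℓ' v', ℓ ≤ ℓ' ∧ (∀ k < ℓ, v' k = v k) ∧ M.runFrom a v' ℓ' = c ∧
      ∀ k < ℓ', (M.runFrom a v' k, v' k) ∈ G := by
  induction hr with
  | refl => exact ⟨ℓ, v, le_rfl, fun _ _ => rfl, hb, hv⟩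
  | tail _ hedge ih =>
    obtain ⟨x, hx, rfl⟩ := hedge
    obtain ⟨ℓ', v', hle, hvv, rfl, hG⟩ := ih
    obtain ⟨v'', h1, h2, h3, h4⟩ := path_extend_edge hG hx
    refine ⟨ℓ' + 1, v'', by omega, fun k hk => ?_, ?_, h4⟩
    · rw [h1 k (by omega), hvv k hk]
    · rw [DPA.runFrom, h2, h3 _ le_rfl]

theorem exists_loop_through [Inhabited A] {G : Set (Q × A)} {q : Q} {e : Q × A} (he : e ∈ G)
    (h1 : M.SameSCC G e.1 q) (h2 : M.SameSCC G (M.trans e.1 e.2) q) :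
    ∃ (ℓ : ℕ) (v : ℕ → A), M.runFrom q v ℓ = q ∧ (∀ k < ℓ, (M.runFrom q v k, v k) ∈ G) ∧
      ∃ k < ℓ, (M.runFrom q v k, v k) = e := by
  obtain ⟨ℓ₁, v₁, -, -, hr₁, hG₁⟩ := path_extend (M := M) (a := q) (v := default) (ℓ := 0) rfl
    (fun k hk => absurd hk (by omega)) h1.2
  obtain ⟨v₂, -, hx, hr₂, hG₂⟩ := path_extend_edge (x := e.2) hG₁ (by rw [hr₁]; exact he)
  obtain ⟨ℓ, v, hle, hv, hr, hG⟩ := path_extend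
    (by rw [DPA.runFrom, hx, hr₂ _ le_rfl, hr₁]) hG₂ h2.1
  refine ⟨ℓ, v, hr, hG, ℓ₁, by omega, ?_⟩
  rw [hv ℓ₁ (by omega), hx, M.runFrom_congr q (w' := v₂) fun k hk => hv k (by omega),
    hr₂ _ le_rfl, hr₁]

theorem recolor_runFrom (M : DPA Q A) (col : Q × A → ℕ) (q : Q) (w : ℕ → A) (n : ℕ) :
    (M.recolor col).runFrom q w n = M.runFrom q w n := by
  induction n with
  | zero => rfl
  | succ n ih => rw [DPA.runFrom, DPA.runFrom, ih]; rfl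

theorem hasLoops_recolor_streamRun [Inhabited A] (M : DPA Q A) {n : ℕ}
    (hn : (M.streamRun n).graph = ∅) : (M.recolor (M.streamRun n).col).HasLoops := by
  intro c hc q x hqx
  have hempty : ∀ t, t ∉ (M.streamRun n).graph := fun t => by simp [hn]
  change c ≤ (M.streamRun n).col (q, x) at hqx
  obtain ⟨m, hm, hmc, hstep, hT, hR⟩ := exists_streamStep_increment hc
    (hqx.trans (streamRun_col_le_counter n _ (hempty _)))
  rw [← streamRun_succ] at hstep
  have hg : (M.streamRun (m + 1)).graph = (M.streamRun m).graph := by rw [hstep]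
  have hcol : (M.streamRun (m + 1)).col = (M.streamRun m).col := by rw [hstep]
  have hcount : (M.streamRun (m + 1)).counter = c := by rw [hstep, ← hmc]
  have hmem : (q, x) ∈ (M.streamRun (m + 1)).graph := by
    rw [hg]
    by_contra hnot
    have h1 := (streamRun_removed hnot hm.le).2
    have h2 := streamRun_col_le_counter m _ hnot
    omega
  obtain ⟨e, he, h1, h2, h3, h4⟩ := streamStep_removes (s := M.streamRun (m + 1))
    (by rwa [hg]) (fun t ht hs hmin => by
      rw [hg] at ht hs
      rw [hg, hcol] at hmin
      have := hR t ht hs hmin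
      rw [hcol, hcount]
      omega) hmem
  rw [← streamRun_succ] at h3 h4
  have hne : m + 1 ≠ n := fun h => hempty (q, x) (h ▸ hmem)
  have hec : (M.streamRun n).col e = c := by
    rw [(streamRun_removed h3 (by omega)).2, h4, hcount]
  obtain ⟨ℓ, v, hr, hG, k, hk, hke⟩ := exists_loop_through he h1 h2
  refine ⟨ℓ, v, ?_, fun i hi => ?_, k, hk, ?_⟩
  · rw [recolor_runFrom, hr]
  · have := (streamRun_counter_le_col _ (show m + 1 ≤ n by omega) (hG i hi)).2
    rw [hcount] at this
    rw [colorsFrom, recolor_runFrom]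
    exact this.resolve_left (hempty _)
  · rw [colorsFrom, recolor_runFrom, ← hec, ← hke]
    rfl

end Streamlining

end DPA

/-- For a streamlined DPA `B`, the maximal color occurring as the least
infinitely often occurring color of some co-run of `B` on `w` equals the natural color
of `w` for `L(B)`. -/
theorem coRun_color_eq_naturalColor {Q : Type u} {A : Type v} [Fintype Q] [Fintype A]
    [Inhabited A] (M : DPA Q A) (hM : M.Structured)
    (n : ℕ) (hn : (M.streamRun n).graph = ∅) (w : ℕ → A) :
    IsGreatest {d | ∃ σ : ℕ → Q, (M.recolor (M.streamRun n).col).IsCoRun w σ ∧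
        (M.recolor (M.streamRun n).col).coRunDom w σ = d}
      (naturalColor (M.recolor (M.streamRun n).col).lang w) := by
  have hloops := M.hasLoops_recolor_streamRun hn
  obtain ⟨d, hd⟩ := (M.recolor (M.streamRun n).col).exists_isGreatest_coRunColors w
  obtain ⟨σ, hσ, hdom⟩ := hd.1
  have hhome := DPA.atHome_of_isGreatest _ d w hd
  have : naturalColor (M.recolor (M.streamRun n).col).lang w = d :=
    le_antisymm (Nat.sInf_le hhome) (le_csInf ⟨d, hhome⟩ fun i hi =>
      hdom ▸ DPA.coRunDom_le_of_atHome hloops i w hi σ hσ)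
  rw [this]
  exact hd
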